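/- arXiv:2305.14442 — 7 statements merged into one kernel-verified Lean document; each statement's English description precedes it below -/
import Mathlib

section
/- Let A be a d×d real symmetric positive definite matrix, σ > 0, and let x, y, g_x, g_y ∈ ℝ^d be arbitrary vectors. Define h(z, v, g) = (1/2)·(z − v − (σ²/4)·A g)ᵀ g. Then −(1/(2σ²))·(x − y − (σ²/2)·A g_y)ᵀ A⁻¹ (x − y − (σ²/2)·A g_y) + (1/(2σ²))·(y − x − (σ²/2)·A g_x)ᵀ A⁻¹ (y − x − (σ²/2)·A g_x) = h(x, y, g_y) − h(y, x, g_x). -/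
open Matrix

/-- Expansion of the quadratic form of `A⁻¹` at `u - c • A g`, for symmetric invertible `A`. -/
theorem Matrix.IsSymm.sub_smul_mulVec_dotProduct_inv_mulVec {n R : Type*} [Fintype n]
    [DecidableEq n] [CommRing R] {A : Matrix n n R} (hA : A.IsSymm) (hdet : IsUnit A.det)
    (c : R) (u g : n → R) :
    (u - c • A *ᵥ g) ⬝ᵥ A⁻¹ *ᵥ (u - c • A *ᵥ g) =
      u ⬝ᵥ A⁻¹ *ᵥ u - 2 * c * (u ⬝ᵥ g) + c ^ 2 * ((A *ᵥ g) ⬝ᵥ g) := by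
  have hinv : A⁻¹ *ᵥ (A *ᵥ g) = g := by
    rw [mulVec_mulVec, nonsing_inv_mul A hdet, one_mulVec]
  have hcross : (A *ᵥ g) ⬝ᵥ A⁻¹ *ᵥ u = u ⬝ᵥ g := by
    rw [dotProduct_comm, dotProduct_mulVec, ← mulVec_transpose, hA.eq, mulVec_mulVec,
      mul_nonsing_inv A hdet, one_mulVec]
  simp only [mulVec_sub, mulVec_smul, hinv, sub_dotProduct, dotProduct_sub, smul_dotProduct,
    dotProduct_smul, hcross, smul_eq_mul]
  ring

/-- Proposition 1: the log-ratio of preconditioned MALA Gaussian proposal densities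
involves no inverse of the preconditioning matrix `A`. -/
theorem mala_acceptance_ratio_no_inverse
    (d : ℕ) (A : Matrix (Fin d) (Fin d) ℝ) (hA : A.PosDef)
    (σ : ℝ) (hσ : 0 < σ) (x y gx gy : Fin d → ℝ)
    (h : (Fin d → ℝ) → (Fin d → ℝ) → (Fin d → ℝ) → ℝ)
    (hh : ∀ z v g, h z v g = (1/2) * ((z - v - (σ^2/4) • A.mulVec g) ⬝ᵥ g)) :
    -(1/(2*σ^2)) * ((x - y - (σ^2/2) • A.mulVec gy) ⬝ᵥ
        A⁻¹.mulVec (x - y - (σ^2/2) • A.mulVec gy))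
      + (1/(2*σ^2)) * ((y - x - (σ^2/2) • A.mulVec gx) ⬝ᵥ
        A⁻¹.mulVec (y - x - (σ^2/2) • A.mulVec gx))
      = h x y gy - h y x gx := by
  have hsymm : A.IsSymm := by simpa using hA.isHermitian
  have hdet : IsUnit A.det := hA.det_pos.ne'.isUnit
  have hneg : (y - x) ⬝ᵥ A⁻¹ *ᵥ (y - x) = (x - y) ⬝ᵥ A⁻¹ *ᵥ (x - y) := by
    rw [← neg_sub x y, mulVec_neg, neg_dotProduct_neg]
  simp only [hh, hsymm.sub_smul_mulVec_dotProduct_inv_mulVec hdet, hneg,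
    sub_dotProduct _ (_ • _), smul_dotProduct, smul_eq_mul]
  field_simp
  ring
end

section
/- Let M and A be d×d real symmetric positive definite matrices. Then (tr A)² ≤ tr(A M A) · tr(M⁻¹), and equality holds if and only if A = (tr A / tr(M⁻¹))·M⁻¹. -/
open Matrix

/-- For `M` positive definite, the trace of `Bᴴ * M * B` vanishes only if `B = 0`. -/
theorem Matrix.PosDef.trace_conjTranspose_mul_mul_same_eq_zero_iff {m n : Type*} [Fintype m]
    [Fintype n] {M : Matrix m m ℝ} (hM : M.PosDef) (B : Matrix m n ℝ) :
    (Bᴴ * M * B).trace = 0 ↔ B = 0 := by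
  classical
  refine ⟨fun h => ?_, fun h => by simp [h]⟩
  rw [(hM.posSemidef.conjTranspose_mul_mul_same B).trace_eq_zero_iff] at h
  refine Matrix.ext_of_mulVec_single fun i => ?_
  rw [zero_mulVec]
  by_contra hv
  have hpos := hM.dotProduct_mulVec_pos hv
  rw [star_mulVec, ← dotProduct_mulVec, mulVec_mulVec, mulVec_mulVec, h,
    zero_mulVec, dotProduct_zero] at hpos
  exact hpos.false

/-- Expansion of the form `M` at the matrix `A - c • M⁻¹`. -/
theorem Matrix.PosDef.trace_sub_smul_inv {n : Type*} [Fintype n] [DecidableEq n]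
    {M A : Matrix n n ℝ} (hM : M.PosDef) (hA : A.IsHermitian) (c : ℝ) :
    ((A - c • M⁻¹)ᴴ * M * (A - c • M⁻¹)).trace =
      (A * M * A).trace - 2 * c * A.trace + c ^ 2 * (M⁻¹).trace := by
  have hdet : IsUnit M.det := (isUnit_iff_isUnit_det M).mp hM.isUnit
  have hB : (A - c • M⁻¹)ᴴ = A - c • M⁻¹ := by
    rw [conjTranspose_sub, conjTranspose_smul, hA.eq, hM.inv.isHermitian.eq, star_trivial]
  rw [hB]
  simp only [Matrix.sub_mul, Matrix.mul_sub, smul_mul_assoc, mul_smul_comm,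
    nonsing_inv_mul M hdet, mul_nonsing_inv_cancel_right M _ hdet, Matrix.one_mul,
    trace_sub, trace_smul, smul_eq_mul]
  ring

/-- Trace Cauchy–Schwarz: `(tr A)² ≤ tr(A M A)·tr(M⁻¹)`, with equality iff
`A` is proportional to `M⁻¹` (Proposition 3). -/
theorem trace_cauchy_schwarz_optimal_preconditioner
    (d : ℕ) (M A : Matrix (Fin d) (Fin d) ℝ) (hM : M.PosDef) (hA : A.PosDef) :
    (A.trace)^2 ≤ (A * M * A).trace * (M⁻¹).trace ∧
    ((A.trace)^2 = (A * M * A).trace * (M⁻¹).trace ↔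
      A = (A.trace / (M⁻¹).trace) • M⁻¹) := by
  rcases isEmpty_or_nonempty (Fin d) with _ | _
  · exact ⟨by simp [trace], fun _ => Matrix.ext fun i => isEmptyElim i, fun _ => by simp [trace]⟩
  have hm : 0 < (M⁻¹).trace := hM.inv.trace_pos
  set B := A - (A.trace / (M⁻¹).trace) • M⁻¹ with hB
  have key : (A * M * A).trace * (M⁻¹).trace - A.trace ^ 2 =
      (Bᴴ * M * B).trace * (M⁻¹).trace := by
    rw [hB, hM.trace_sub_smul_inv hA.isHermitian]
    field_simp
    ring
  have hnonneg := mul_nonneg (hM.posSemidef.conjTranspose_mul_mul_same B).trace_nonneg hm.le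
  refine ⟨sub_nonneg.mp (key ▸ hnonneg), ?_⟩
  rw [eq_comm, ← sub_eq_zero, key, mul_eq_zero_iff_right hm.ne',
    hM.trace_conjTranspose_mul_mul_same_eq_zero_iff, hB, sub_eq_zero]
end

section
/- Let z ∈ ℝ^d with zᵀz ≤ 1, and set r = 1/(1 + √(1 − zᵀz)) and R = I_d − r·z zᵀ. Then R Rᵀ = I_d − z zᵀ. -/
open Matrix

/-- Lemma 1: explicit square root of a rank-one downdate of the identity:
with `r = 1/(1 + √(1 − zᵀz))` and `R = I − r z zᵀ`, one has `R Rᵀ = I − z zᵀ`. -/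
theorem square_root_rank_one_downdate
    (d : ℕ) (z : Fin d → ℝ) (hz : z ⬝ᵥ z ≤ 1)
    (r : ℝ) (hr : r = 1 / (1 + Real.sqrt (1 - z ⬝ᵥ z)))
    (R : Matrix (Fin d) (Fin d) ℝ)
    (hR : R = 1 - r • vecMulVec z z) :
    R * Rᵀ = 1 - vecMulVec z z := by
  have hq := Real.sq_sqrt (sub_nonneg.mpr hz)
  have hq_pos : 1 + √(1 - z ⬝ᵥ z) ≠ 0 := by positivity
  have hcoeff : 2 * r - r ^ 2 * (z ⬝ᵥ z) = 1 := by
    rw [hr]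
    field_simp
    linear_combination -hq
  have hsq : vecMulVec z z * vecMulVec z z = (z ⬝ᵥ z) • vecMulVec z z := by
    rw [vecMulVec_mul_vecMulVec, vecMulVec_smul]
  have hRT : Rᵀ = R := by
    simp [hR, transpose_vecMulVec]
  calc R * Rᵀ = 1 - (2 * r - r ^ 2 * (z ⬝ᵥ z)) • vecMulVec z z := by
        rw [hRT, hR, sub_mul, mul_sub, mul_sub, smul_mul_smul_comm, hsq]
        simp only [mul_one, one_mul]
        module
    _ = 1 - vecMulVec z z := by rw [hcoeff, one_smul]
end

section
/- Let λ > 0 and s ∈ ℝ^d. Set r₁ = 1/(1 + √(λ/(λ + sᵀs))) and R₁ = (1/√λ)·(I_d − (r₁/(λ + sᵀs))·s sᵀ). Then R₁ R₁ᵀ = (s sᵀ + λ·I_d)⁻¹. -/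
open Matrix

/-- The scalar identity behind the square-root update: with `q = √(a / (a + t))` and
`r = 1 / (1 + q)`, the coefficient `c = r / (a + t)` satisfies `2 c - c² t = 1 / (a + t)`. -/
lemma two_mul_sub_sq_mul_eq_inv {a t : ℝ} (ha : 0 < a) (ht : 0 ≤ t) :
    2 * (1 / (1 + Real.sqrt (a / (a + t))) / (a + t))
      - (1 / (1 + Real.sqrt (a / (a + t))) / (a + t)) ^ 2 * t = (a + t)⁻¹ := by
  have hat : 0 < a + t := by positivity
  have hq : Real.sqrt (a / (a + t)) ^ 2 = a / (a + t) := Real.sq_sqrt (by positivity)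
  have hq0 := Real.sqrt_nonneg (a / (a + t))
  generalize Real.sqrt (a / (a + t)) = q at hq hq0 ⊢
  have hq1 : 1 + q ≠ 0 := by positivity
  rw [eq_div_iff hat.ne'] at hq
  field_simp
  linear_combination -hq

/-- The square of a rank-one perturbation `1 - c • s sᵀ` of the identity. -/
lemma one_sub_smul_vecMulVec_mul_self {n : Type*} [Fintype n] [DecidableEq n]
    (c : ℝ) (s : n → ℝ) :
    (1 - c • vecMulVec s s) * (1 - c • vecMulVec s s)
      = 1 - (2 * c - c ^ 2 * (s ⬝ᵥ s)) • vecMulVec s s := by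
  simp only [sub_mul, mul_sub, one_mul, mul_one, smul_mul_assoc, mul_smul_comm,
    vecMulVec_mul_vecMulVec, vecMulVec_smul]
  module

/-- The Sherman–Morrison formula for `s sᵀ + a I`. -/
lemma inv_vecMulVec_add_smul_one {n : Type*} [Fintype n] [DecidableEq n]
    {a : ℝ} (ha : a ≠ 0) (s : n → ℝ) (hs : a + s ⬝ᵥ s ≠ 0) :
    (vecMulVec s s + a • (1 : Matrix n n ℝ))⁻¹
      = a⁻¹ • (1 - (a + s ⬝ᵥ s)⁻¹ • vecMulVec s s) := by
  refine inv_eq_left_inv ?_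
  simp only [sub_mul, mul_add, one_mul, mul_one, smul_mul_assoc, mul_smul_comm,
    vecMulVec_mul_vecMulVec, vecMulVec_smul]
  match_scalars <;> field_simp
  ring

/-- Initialization of the square-root recursion (Proposition 4):
`R₁ R₁ᵀ = (s sᵀ + λ I)⁻¹`. -/
theorem square_root_recursion_initialization
    (d : ℕ) (lam : ℝ) (hlam : 0 < lam) (s : Fin d → ℝ)
    (r₁ : ℝ) (hr₁ : r₁ = 1 / (1 + Real.sqrt (lam / (lam + s ⬝ᵥ s))))
    (R₁ : Matrix (Fin d) (Fin d) ℝ)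
    (hR₁ : R₁ = (1 / Real.sqrt lam) • ((1 : Matrix (Fin d) (Fin d) ℝ)
        - (r₁ / (lam + s ⬝ᵥ s)) • vecMulVec s s)) :
    R₁ * R₁ᵀ = (vecMulVec s s + lam • (1 : Matrix (Fin d) (Fin d) ℝ))⁻¹ := by
  have ht : 0 ≤ s ⬝ᵥ s := Finset.sum_nonneg fun i _ => mul_self_nonneg (s i)
  have hsymm : R₁ᵀ = R₁ := by
    simp only [hR₁, transpose_smul, transpose_sub, transpose_one, transpose_vecMulVec]
  have hsqrt : 1 / Real.sqrt lam * (1 / Real.sqrt lam) = lam⁻¹ := by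
    rw [one_div, ← mul_inv, Real.mul_self_sqrt hlam.le]
  rw [hsymm, inv_vecMulVec_add_smul_one hlam.ne' s (by positivity), hR₁, smul_mul_assoc,
    mul_smul_comm, smul_smul, hsqrt, one_sub_smul_vecMulVec_mul_self, hr₁,
    two_mul_sub_sq_mul_eq_inv hlam ht]
end

section
/- Let R be an invertible d×d real matrix, A = R Rᵀ, and s ∈ ℝ^d. Set φ = Rᵀ s, r = 1/(1 + √(1/(1 + φᵀφ))), and R' = R − (r/(1 + φᵀφ))·(R φ) φᵀ. Then R' (R')ᵀ = A − (1/(1 + sᵀA s))·A s sᵀ A = (A⁻¹ + s sᵀ)⁻¹. -/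
open Matrix

theorem vecMulVec_mul_mul_vecMulVec {n : Type*} [Fintype n] (A : Matrix n n ℝ) (s : n → ℝ) :
    vecMulVec s s * A * vecMulVec s s = (s ⬝ᵥ A *ᵥ s) • vecMulVec s s := by
  rw [Matrix.mul_assoc, mul_vecMulVec, vecMulVec_mul_vecMulVec, vecMulVec_smul]

/-- The Sherman–Morrison formula for a symmetric rank-one update of `A⁻¹`. -/
theorem inv_add_vecMulVec_inv {n : Type*} [Fintype n] [DecidableEq n] {A : Matrix n n ℝ}
    (hA : IsUnit A.det) (s : n → ℝ) (hs : 1 + s ⬝ᵥ A *ᵥ s ≠ 0) :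
    (A⁻¹ + vecMulVec s s)⁻¹ = A - (1 / (1 + s ⬝ᵥ A *ᵥ s)) • (A * vecMulVec s s * A) := by
  apply inv_eq_right_inv
  have h₁ : A⁻¹ * (A * vecMulVec s s * A) = vecMulVec s s * A := by
    rw [Matrix.mul_assoc, nonsing_inv_mul_cancel_left _ _ hA]
  have h₂ : vecMulVec s s * (A * vecMulVec s s * A)
      = (s ⬝ᵥ A *ᵥ s) • (vecMulVec s s * A) := by
    rw [← Matrix.mul_assoc, ← Matrix.mul_assoc, vecMulVec_mul_mul_vecMulVec, Matrix.smul_mul]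
  rw [Matrix.mul_sub, Matrix.add_mul, Matrix.mul_smul, Matrix.add_mul, h₁, h₂,
    nonsing_inv_mul _ hA]
  match_scalars <;> field_simp
  ring

theorem one_sub_smul_vecMulVec_sq {n : Type*} [Fintype n] [DecidableEq n] (c : ℝ) (v : n → ℝ) :
    (1 - c • vecMulVec v v) * (1 - c • vecMulVec v v)
      = 1 - (2 * c - c ^ 2 * (v ⬝ᵥ v)) • vecMulVec v v := by
  have h : vecMulVec v v * vecMulVec v v = (v ⬝ᵥ v) • vecMulVec v v := by
    simpa using vecMulVec_mul_mul_vecMulVec 1 v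
  simp only [Matrix.sub_mul, Matrix.mul_sub, Matrix.smul_mul, Matrix.mul_smul, h,
    Matrix.one_mul, Matrix.mul_one]
  module

theorem two_mul_sub_sq_mul_eq_one_div {q : ℝ} (hq : 0 ≤ q) :
    2 * (1 / (1 + √(1 / (1 + q))) / (1 + q)) - (1 / (1 + √(1 / (1 + q))) / (1 + q)) ^ 2 * q
      = 1 / (1 + q) := by
  obtain ⟨t, ht, rfl⟩ : ∃ t : ℝ, 0 < t ∧ q = t ^ 2 - 1 :=
    ⟨√(1 + q), by positivity, by rw [Real.sq_sqrt (by positivity)]; ring⟩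
  have h : √(1 / (1 + (t ^ 2 - 1))) = 1 / t := by
    rw [add_sub_cancel, Real.sqrt_div zero_le_one, Real.sqrt_one, Real.sqrt_sq ht.le]
  rw [h, add_sub_cancel]
  field_simp
  ring

/-- Iteration step of the square-root recursion (Proposition 4): the updated factor
`R'` is a square root of the rank-one Woodbury update of `A = R Rᵀ`. -/
theorem square_root_recursion_step
    (d : ℕ) (R : Matrix (Fin d) (Fin d) ℝ) (hR : IsUnit R)
    (A : Matrix (Fin d) (Fin d) ℝ) (hA : A = R * Rᵀ) (s : Fin d → ℝ)
    (φ : Fin d → ℝ) (hφ : φ = Rᵀ.mulVec s)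
    (r : ℝ) (hr : r = 1 / (1 + Real.sqrt (1 / (1 + φ ⬝ᵥ φ))))
    (R' : Matrix (Fin d) (Fin d) ℝ)
    (hR' : R' = R - (r / (1 + φ ⬝ᵥ φ)) • vecMulVec (R.mulVec φ) φ) :
    R' * R'ᵀ = A - (1/(1 + s ⬝ᵥ A.mulVec s)) • (A * vecMulVec s s * A) ∧
    R' * R'ᵀ = (A⁻¹ + vecMulVec s s)⁻¹ := by
  have hq : 0 ≤ φ ⬝ᵥ φ := by simpa using dotProduct_star_self_nonneg φ
  have hsA : s ⬝ᵥ A *ᵥ s = φ ⬝ᵥ φ := by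
    rw [hA, hφ, ← mulVec_mulVec, dotProduct_mulVec, ← mulVec_transpose]
  have hAdet : IsUnit A.det := by
    have := (isUnit_iff_isUnit_det R).1 hR
    rw [hA, det_mul, det_transpose]
    exact this.mul this
  have hP : R * vecMulVec φ φ * Rᵀ = A * vecMulVec s s * A := by
    rw [hA, mul_vecMulVec, vecMulVec_mul, mul_vecMulVec, vecMulVec_mul, ← mulVec_transpose,
      ← mulVec_transpose, transpose_mul, transpose_transpose, hφ, mulVec_mulVec]
  have key : R' * R'ᵀ = A - (1 / (1 + s ⬝ᵥ A *ᵥ s)) • (A * vecMulVec s s * A) := by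
    have hfac : R' = R * (1 - (r / (1 + φ ⬝ᵥ φ)) • vecMulVec φ φ) := by
      rw [hR', Matrix.mul_sub, Matrix.mul_one, Matrix.mul_smul, mul_vecMulVec]
    have hsymm : (1 - (r / (1 + φ ⬝ᵥ φ)) • vecMulVec φ φ)ᵀ
        = 1 - (r / (1 + φ ⬝ᵥ φ)) • vecMulVec φ φ := by
      rw [transpose_sub, transpose_one, transpose_smul, transpose_vecMulVec]
    rw [hfac, transpose_mul, hsymm, Matrix.mul_assoc, ← Matrix.mul_assoc _ _ Rᵀ,
      one_sub_smul_vecMulVec_sq, hr, two_mul_sub_sq_mul_eq_one_div hq, Matrix.sub_mul,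
      Matrix.mul_sub, Matrix.one_mul, Matrix.smul_mul, Matrix.mul_smul, ← Matrix.mul_assoc, hP,
      hsA, hA]
  exact ⟨key, key.trans (inv_add_vecMulVec_inv hAdet s (by rw [hsA]; positivity)).symm⟩
end

section
/- Let λ > 0 and let (s_n)_{n≥1} be a sequence of vectors in ℝ^d. Define R_1 = (1/√λ)·(I_d − (r_1/(λ + s_1ᵀs_1))·s_1 s_1ᵀ) with r_1 = 1/(1 + √(λ/(λ + s_1ᵀs_1))), and for n ≥ 2 define φ_n = R_{n−1}ᵀ s_n, r_n = 1/(1 + √(1/(1 + φ_nᵀφ_n))), and R_n = R_{n−1} − (r_n/(1 + φ_nᵀφ_n))·(R_{n−1} φ_n) φ_nᵀ. Then for every n ≥ 1, the matrix Σ_{i=1}^n s_i s_iᵀ + λ·I_d is invertible and R_n R_nᵀ = (Σ_{i=1}^n s_i s_iᵀ + λ·I_d)⁻¹. -/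
open Matrix

/-- A rank-one downdate `R (1 - c φ φᵀ)` of a square-root factor `R` of `A⁻¹`, with `φ = Rᵀ s`, is a
square-root factor of `(A + s sᵀ)⁻¹`, for `c` a root of a suitable quadratic equation. -/
theorem add_vecMulVec_mul_rankOne_downdate {n K : Type*} [Fintype n] [DecidableEq n] [Field K]
    {A R : Matrix n n K} (h : A * (R * Rᵀ) = 1) (s φ : n → K) (hφ : φ = Rᵀ *ᵥ s) {c : K}
    (hc : (2 * c - c ^ 2 * (φ ⬝ᵥ φ)) * (1 + φ ⬝ᵥ φ) = 1) :
    (A + vecMulVec s s) * ((R - c • vecMulVec (R *ᵥ φ) φ) * (R - c • vecMulVec (R *ᵥ φ) φ)ᵀ)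
      = 1 := by
  set t := φ ⬝ᵥ φ with ht
  set w := R *ᵥ φ with hw
  have hAw : A *ᵥ w = s := by
    rw [hw, hφ, mulVec_mulVec, mulVec_mulVec, Matrix.mul_assoc, h, one_mulVec]
  have hsR : s ᵥ* R = φ := by rw [hφ, mulVec_transpose]
  have hφR : φ ᵥ* Rᵀ = w := by rw [vecMul_transpose]
  have hsw : s ⬝ᵥ w = t := by rw [hw, dotProduct_mulVec, hsR]
  have hprod : (R - c • vecMulVec w φ) * (R - c • vecMulVec w φ)ᵀ
      = R * Rᵀ - (2 * c - c ^ 2 * t) • vecMulVec w w := by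
    simp only [transpose_sub, transpose_smul, transpose_vecMulVec, sub_mul, mul_sub,
      Matrix.smul_mul, Matrix.mul_smul, mul_vecMulVec, vecMulVec_mul, hφR,
      ← hw, smul_mulVec, vecMulVec_mulVec, ← ht, op_smul_eq_smul, smul_vecMulVec]
    module
  rw [hprod, add_mul, mul_sub, mul_sub, h, Matrix.mul_smul, Matrix.mul_smul, mul_vecMulVec,
    mul_vecMulVec, hAw, vecMulVec_mul, ← vecMul_vecMul, hsR, hφR, vecMulVec_mulVec, hsw,
    op_smul_eq_smul, smul_vecMulVec]
  match_scalars
  · ring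
  · linear_combination -hc

/-- The step coefficient of the square-root recursion solves the quadratic equation of
`add_vecMulVec_mul_rankOne_downdate`. -/
theorem sqrt_step_coefficient {t : ℝ} (ht : 0 ≤ t) :
    (2 * (1 / (1 + √(1 / (1 + t))) / (1 + t)) - (1 / (1 + √(1 / (1 + t))) / (1 + t)) ^ 2 * t)
      * (1 + t) = 1 := by
  have hu : 0 ≤ √(1 / (1 + t)) := Real.sqrt_nonneg _
  have hsq : √(1 / (1 + t)) ^ 2 = 1 / (1 + t) := Real.sq_sqrt (by positivity)
  generalize √(1 / (1 + t)) = u at hu hsq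
  have h1 : 1 + t ≠ 0 := by positivity
  have h2 : 1 + u ≠ 0 := by positivity
  field_simp at hsq ⊢
  linear_combination (-1) * hsq

/-- The factor of `(A + v vᵀ)⁻¹` computed from a factor `Q` of `A⁻¹`. -/
noncomputable def sqrtStep {n : Type*} [Fintype n] (Q : Matrix n n ℝ) (v : n → ℝ) : Matrix n n ℝ :=
  let φ := Qᵀ *ᵥ v
  let r := 1 / (1 + √(1 / (1 + φ ⬝ᵥ φ)))
  Q - (r / (1 + φ ⬝ᵥ φ)) • vecMulVec (Q *ᵥ φ) φ

theorem add_vecMulVec_mul_sqrtStep {n : Type*} [Fintype n] [DecidableEq n] {A Q : Matrix n n ℝ}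
    (h : A * (Q * Qᵀ) = 1) (v : n → ℝ) :
    (A + vecMulVec v v) * (sqrtStep Q v * (sqrtStep Q v)ᵀ) = 1 :=
  add_vecMulVec_mul_rankOne_downdate h v _ rfl
    (sqrt_step_coefficient (Finset.sum_nonneg fun _ _ ↦ mul_self_nonneg _))

theorem one_div_sqrt_mul_self {lam : ℝ} (hlam : 0 ≤ lam) : (1 / √lam) * (1 / √lam) = 1 / lam := by
  rw [div_mul_div_comm, Real.mul_self_sqrt hlam, one_mul]

/-- The first step of the recursion, started at the factor `λ^(-1/2) I` of `(λ I)⁻¹`. -/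
theorem sqrtStep_smul_one {n : Type*} [Fintype n] [DecidableEq n] {lam : ℝ} (hlam : 0 < lam)
    (v : n → ℝ) :
    sqrtStep ((1 / √lam) • (1 : Matrix n n ℝ)) v = (1 / √lam) • ((1 : Matrix n n ℝ)
      - ((1 / (1 + √(lam / (lam + v ⬝ᵥ v)))) / (lam + v ⬝ᵥ v)) • vecMulVec v v) := by
  have hv : 0 ≤ v ⬝ᵥ v := Finset.sum_nonneg fun _ _ ↦ mul_self_nonneg _
  have hq : 1 + 1 / lam * (v ⬝ᵥ v) = (lam + v ⬝ᵥ v) / lam := by field_simp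
  have hφ : ((1 / √lam) • (1 : Matrix n n ℝ))ᵀ *ᵥ v = (1 / √lam) • v := by
    rw [transpose_smul, transpose_one, smul_mulVec, one_mulVec]
  have hφφ : ((1 / √lam) • v) ⬝ᵥ ((1 / √lam) • v) = 1 / lam * (v ⬝ᵥ v) := by
    rw [smul_dotProduct, dotProduct_smul, smul_smul, one_div_sqrt_mul_self hlam.le, smul_eq_mul]
  simp only [sqrtStep, hφ, hφφ, hq, one_div_div, smul_mulVec, one_mulVec, smul_vecMulVec,
    vecMulVec_smul, smul_sub]
  match_scalars
  · ring
  · have h0 : lam + v ⬝ᵥ v ≠ 0 := by positivity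
    have h2 := one_div_sqrt_mul_self hlam.le
    generalize 1 / √lam = a at h2 ⊢
    have h3 : lam * a ^ 2 = 1 := by rw [sq, h2, mul_one_div_cancel hlam.ne']
    field_simp
    linear_combination -a * h3

/-- Proposition 4 in full: the recursively computed matrices `R n` are square-root
factors of the damped inverse empirical Fisher estimates
`A n = (Σ_{i=1}^n s_i s_iᵀ + λ I)⁻¹`. -/
theorem square_root_recursion_correct
    (d : ℕ) (lam : ℝ) (hlam : 0 < lam) (s : ℕ → Fin d → ℝ)
    (R : ℕ → Matrix (Fin d) (Fin d) ℝ)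
    (hR1 : R 1 = (1 / Real.sqrt lam) • ((1 : Matrix (Fin d) (Fin d) ℝ)
        - ((1 / (1 + Real.sqrt (lam / (lam + s 1 ⬝ᵥ s 1)))) / (lam + s 1 ⬝ᵥ s 1)) •
          vecMulVec (s 1) (s 1)))
    (hRstep : ∀ n, 1 ≤ n →
        let φ := (R n)ᵀ.mulVec (s (n+1))
        let r := 1 / (1 + Real.sqrt (1 / (1 + φ ⬝ᵥ φ)))
        R (n+1) = R n - (r / (1 + φ ⬝ᵥ φ)) • vecMulVec ((R n).mulVec φ) φ) :
    ∀ n, 1 ≤ n →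
      IsUnit (∑ i ∈ Finset.Icc 1 n, vecMulVec (s i) (s i)
          + lam • (1 : Matrix (Fin d) (Fin d) ℝ)) ∧
      R n * (R n)ᵀ = (∑ i ∈ Finset.Icc 1 n, vecMulVec (s i) (s i)
          + lam • (1 : Matrix (Fin d) (Fin d) ℝ))⁻¹ := by
  have key : ∀ n, 1 ≤ n → (∑ i ∈ Finset.Icc 1 n, vecMulVec (s i) (s i)
      + lam • (1 : Matrix (Fin d) (Fin d) ℝ)) * (R n * (R n)ᵀ) = 1 := by
    intro n hn
    induction n, hn using Nat.le_induction with
    | base =>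
      rw [Finset.Icc_self, Finset.sum_singleton, add_comm, hR1, ← sqrtStep_smul_one hlam]
      refine add_vecMulVec_mul_sqrtStep ?_ _
      simp only [transpose_smul, transpose_one, Matrix.smul_mul, Matrix.mul_smul, smul_smul,
        one_mul, one_div_sqrt_mul_self hlam.le]
      rw [one_div_mul_cancel hlam.ne', one_smul]
    | succ n hn ih =>
      rw [Finset.sum_Icc_succ_top (by lia), add_right_comm, hRstep n hn]
      exact add_vecMulVec_mul_sqrtStep ih (s (n + 1))
  exact fun n hn ↦ ⟨IsUnit.of_mul_eq_one _ (key n hn), (inv_eq_right_inv (key n hn)).symm⟩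
end

section
/- Let γ ∈ (0, 1), let R be an invertible d×d real matrix, A = R Rᵀ, and s ∈ ℝ^d. Set φ = Rᵀ s, c = (1−γ)/γ, r = 1/(1 + √(c/(c + φᵀφ))), and R' = (1/√(1−γ))·(R − (r/(c + φᵀφ))·(R φ) φᵀ). Then R' (R')ᵀ = ((1−γ)·A⁻¹ + γ·s sᵀ)⁻¹. -/
open Matrix

section RankOne

variable {n 𝕜 : Type*} [Fintype n]

/-- Gram matrix of a rank-one right perturbation `R (1 - α φ φᵀ)`. -/
theorem sub_smul_vecMulVec_mul_transpose [CommRing 𝕜] (R : Matrix n n 𝕜) (φ : n → 𝕜) (α : 𝕜) :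
    (R - α • vecMulVec (R *ᵥ φ) φ) * (R - α • vecMulVec (R *ᵥ φ) φ)ᵀ =
      R * Rᵀ - (2 * α - α ^ 2 * (φ ⬝ᵥ φ)) • vecMulVec (R *ᵥ φ) (R *ᵥ φ) := by
  have h₁ : R * vecMulVec φ (R *ᵥ φ) = vecMulVec (R *ᵥ φ) (R *ᵥ φ) := mul_vecMulVec ..
  have h₂ : vecMulVec (R *ᵥ φ) φ * Rᵀ = vecMulVec (R *ᵥ φ) (R *ᵥ φ) := by
    rw [vecMulVec_mul, vecMul_transpose]
  have h₃ : vecMulVec (R *ᵥ φ) φ * vecMulVec φ (R *ᵥ φ) =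
      (φ ⬝ᵥ φ) • vecMulVec (R *ᵥ φ) (R *ᵥ φ) := by
    rw [vecMulVec_mul_vecMulVec, vecMulVec_smul]
  simp only [transpose_sub, transpose_smul, transpose_vecMulVec, sub_mul, mul_sub, Matrix.smul_mul,
    Matrix.mul_smul, h₁, h₂, h₃]
  module

/-- Sherman–Morrison formula for a symmetric rank-one update of a symmetric matrix. -/
theorem inv_smul_inv_add_smul_vecMulVec [DecidableEq n] [Field 𝕜] (A : Matrix n n 𝕜)
    (hA : IsUnit A) (hsymm : Aᵀ = A) (s : n → 𝕜) (a b : 𝕜) (ha : a ≠ 0)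
    (hab : a + b * (s ⬝ᵥ A *ᵥ s) ≠ 0) :
    (a • A⁻¹ + b • vecMulVec s s)⁻¹ =
      a⁻¹ • (A - (b / (a + b * (s ⬝ᵥ A *ᵥ s))) • vecMulVec (A *ᵥ s) (A *ᵥ s)) := by
  have hdet : IsUnit A.det := (isUnit_iff_isUnit_det A).mp hA
  have h₁ : A⁻¹ * vecMulVec (A *ᵥ s) (A *ᵥ s) = vecMulVec s (A *ᵥ s) := by
    rw [mul_vecMulVec, mulVec_mulVec, nonsing_inv_mul A hdet, one_mulVec]
  have h₂ : vecMulVec s s * A = vecMulVec s (A *ᵥ s) := by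
    rw [vecMulVec_mul, ← mulVec_transpose, hsymm]
  have h₃ : vecMulVec s s * vecMulVec (A *ᵥ s) (A *ᵥ s) =
      (s ⬝ᵥ A *ᵥ s) • vecMulVec s (A *ᵥ s) := by
    rw [vecMulVec_mul_vecMulVec, vecMulVec_smul]
  apply inv_eq_right_inv
  simp only [Matrix.mul_smul, add_mul, mul_sub, Matrix.smul_mul, h₁, h₂, h₃, nonsing_inv_mul A hdet]
  match_scalars
  · field_simp
  · field_simp
    ring

end RankOne

theorem two_mul_sub_sq_mul_of_eq_inv_one_add_sqrt {c t r : ℝ} (hc : 0 < c) (ht : 0 ≤ t)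
    (hr : r = 1 / (1 + √(c / (c + t)))) :
    2 * (r / (c + t)) - (r / (c + t)) ^ 2 * t = 1 / (c + t) := by
  have hct : 0 < c + t := by positivity
  have hq : √(c / (c + t)) ^ 2 = c / (c + t) := Real.sq_sqrt (by positivity)
  have hq0 : 0 ≤ √(c / (c + t)) := Real.sqrt_nonneg _
  generalize √(c / (c + t)) = q at *
  have hq1 : 1 + q ≠ 0 := by positivity
  rw [eq_div_iff hct.ne'] at hq
  subst hr
  field_simp
  linear_combination -hq

/-- Square-root recursion step for the stochastic-approximation Fisher estimate
with general learning rate `γ ∈ (0,1)`. -/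
theorem stochastic_approximation_square_root_step
    (d : ℕ) (γ : ℝ) (hγ : γ ∈ Set.Ioo (0 : ℝ) 1)
    (R : Matrix (Fin d) (Fin d) ℝ) (hR : IsUnit R)
    (A : Matrix (Fin d) (Fin d) ℝ) (hA : A = R * Rᵀ) (s : Fin d → ℝ)
    (φ : Fin d → ℝ) (hφ : φ = Rᵀ.mulVec s)
    (c : ℝ) (hc : c = (1 - γ)/γ)
    (r : ℝ) (hr : r = 1 / (1 + Real.sqrt (c / (c + φ ⬝ᵥ φ))))
    (R' : Matrix (Fin d) (Fin d) ℝ)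
    (hR' : R' = (1 / Real.sqrt (1 - γ)) •
        (R - (r / (c + φ ⬝ᵥ φ)) • vecMulVec (R.mulVec φ) φ)) :
    R' * R'ᵀ = ((1 - γ) • A⁻¹ + γ • vecMulVec s s)⁻¹ := by
  obtain ⟨hγ₀, hγ₁⟩ := hγ
  have hγ' : 0 < 1 - γ := sub_pos.mpr hγ₁
  have ht : 0 ≤ φ ⬝ᵥ φ := by simpa using dotProduct_star_self_nonneg φ
  have hc₀ : 0 < c := hc ▸ div_pos hγ' hγ₀
  have hAs : R *ᵥ φ = A *ᵥ s := by rw [hφ, hA, mulVec_mulVec]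
  have hsA : s ⬝ᵥ A *ᵥ s = φ ⬝ᵥ φ := by
    rw [← hAs, dotProduct_mulVec, ← mulVec_transpose, ← hφ]
  have hAunit : IsUnit A := hA ▸ hR.mul ((isUnit_transpose R).mpr hR)
  have hAsymm : Aᵀ = A := by rw [hA, transpose_mul, transpose_transpose]
  have hpos : 0 < 1 - γ + γ * (φ ⬝ᵥ φ) := by positivity
  have hcoef : γ / (1 - γ + γ * (φ ⬝ᵥ φ)) = 1 / (c + φ ⬝ᵥ φ) := by
    rw [div_eq_div_iff hpos.ne' (by positivity), hc]
    field_simp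
  have hscale : 1 / √(1 - γ) * (1 / √(1 - γ)) = (1 - γ)⁻¹ := by
    rw [div_mul_div_comm, Real.mul_self_sqrt hγ'.le, one_mul, one_div]
  rw [inv_smul_inv_add_smul_vecMulVec A hAunit hAsymm s _ _ hγ'.ne' (hsA ▸ hpos.ne'), hsA, hcoef,
    hR', transpose_smul, Matrix.smul_mul, Matrix.mul_smul, smul_smul, hscale,
    sub_smul_vecMulVec_mul_transpose, two_mul_sub_sq_mul_of_eq_inv_one_add_sqrt hc₀ ht hr, ← hA, hAs]
end
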